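/- arXiv:2308.04310 — 8 statements merged into one kernel-verified Lean document; each statement's English description precedes it below -/
import Mathlib

section
/- Let ℓ ∈ ℝ and let w be differentiable on an open interval I ⊆ (0,∞), satisfying the Riccati equation w'(s) = ((2ℓ − 1)/s)·w(s) − w(s)² − 1 on I. Then w is twice differentiable on I, and at every s ∈ I with w(s) ≠ 0 it satisfies the Painlevé 3 equation w''(s) = (w'(s))²/w(s) − w'(s)/s − 2ℓ·w(s)²/s + (2ℓ − 2)/s + w(s)³ − 1/w(s). -/
/-- If `w` is differentiable on an open interval `I ⊆ (0,∞)` and satisfies the Riccati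
equation `w' = ((2ℓ−1)/s)w − w² − 1` on `I`, then `w` is twice differentiable on `I` and
satisfies the Painlevé 3 equation at every `s ∈ I` where `w s ≠ 0`. -/
theorem stmt_3 (ℓ : ℝ) (I : Set ℝ) (hIopen : IsOpen I) (hIconn : I.OrdConnected)
    (hIpos : I ⊆ Set.Ioi 0) (w : ℝ → ℝ)
    (hw : ∀ s ∈ I, DifferentiableAt ℝ w s)
    (hode : ∀ s ∈ I, deriv w s = ((2*ℓ - 1)/s) * w s - (w s)^2 - 1) :
    (∀ s ∈ I, DifferentiableAt ℝ (deriv w) s) ∧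
    (∀ s ∈ I, w s ≠ 0 → deriv (deriv w) s =
      (deriv w s)^2 / w s - deriv w s / s - 2*ℓ*(w s)^2/s + (2*ℓ - 2)/s
        + (w s)^3 - 1/(w s)) := by
  have key : ∀ s ∈ I, HasDerivAt (deriv w)
      ((2*ℓ - 1) * (-(s^2)⁻¹) * w s + ((2*ℓ - 1) * s⁻¹) * deriv w s
        - 2 * w s * deriv w s) s := by
    intro s hs
    have hs0 : s ≠ 0 := ne_of_gt (hIpos hs)
    have h1 := (hw s hs).hasDerivAt
    have h2 := (((hasDerivAt_inv hs0).const_mul (2*ℓ - 1)).mul h1).sub (h1.pow 2)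
    have h3 := h2.sub_const 1
    have h4 := h3.congr_of_eventuallyEq (f₁ := deriv w) (by
      filter_upwards [hIopen.mem_nhds hs] with x hx
      rw [hode x hx]
      simp [div_eq_mul_inv])
    refine h4.congr_deriv ?_
    norm_num
  refine ⟨fun s hs => (key s hs).differentiableAt, fun s hs h0 => ?_⟩
  have hs0 : s ≠ 0 := ne_of_gt (hIpos hs)
  rw [(key s hs).deriv, hode s hs]
  field_simp
  ring
end

section
/- Let ℓ ∈ ℝ and let v : (0,∞) → ℝ be a twice differentiable solution of the Bessel equation v''(s) + v'(s)/s + (1 − ℓ²/s²)·v(s) = 0. Set u(s) := s^ℓ · v(s) and w(s) := u'(s)/u(s) on the open set where u(s) ≠ 0. Then at every s > 0 with u(s) ≠ 0 and w(s) ≠ 0, w satisfies the Painlevé 3 equation w''(s) = (w'(s))²/w(s) − w'(s)/s − 2ℓ·w(s)²/s + (2ℓ − 2)/s + w(s)³ − 1/w(s). -/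
/-- Bessel type solutions of Painlevé 3: if `v` solves the Bessel equation of order `ℓ`
on `(0,∞)`, `u(s) := s^ℓ v(s)` and `w := u'/u`, then at every `s > 0` with `u s ≠ 0` and
`w s ≠ 0`, `w` satisfies the Painlevé 3 equation. -/
theorem stmt_4 (ℓ : ℝ) (v : ℝ → ℝ)
    (hv : ∀ s : ℝ, 0 < s → DifferentiableAt ℝ v s)
    (hv' : ∀ s : ℝ, 0 < s → DifferentiableAt ℝ (deriv v) s)
    (hbessel : ∀ s : ℝ, 0 < s →
      deriv (deriv v) s + deriv v s / s + (1 - ℓ^2/s^2) * v s = 0)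
    (u w : ℝ → ℝ) (hu : u = fun s => s ^ ℓ * v s)
    (hwdef : w = fun s => deriv u s / u s) :
    ∀ s : ℝ, 0 < s → u s ≠ 0 → w s ≠ 0 →
      deriv (deriv w) s = (deriv w s)^2 / w s - deriv w s / s - 2*ℓ*(w s)^2/s
        + (2*ℓ - 2)/s + (w s)^3 - 1/(w s) := by
  have hud : ∀ s : ℝ, 0 < s → HasDerivAt u (ℓ * s ^ ℓ / s * v s + s ^ ℓ * deriv v s) s := by
    intro s hs
    have h1 := Real.hasDerivAt_rpow_const (x := s) (p := ℓ) (Or.inl hs.ne')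
    have h2 := h1.mul (hv s hs).hasDerivAt
    rw [Real.rpow_sub_one hs.ne'] at h2
    rw [hu]
    refine h2.congr_deriv ?_
    ring
  have hudd : ∀ s : ℝ, 0 < s → HasDerivAt (deriv u) ((2 * ℓ - 1) * deriv u s / s - u s) s := by
    intro s hs
    have h1 := Real.hasDerivAt_rpow_const (x := s) (p := ℓ) (Or.inl hs.ne')
    rw [Real.rpow_sub_one hs.ne'] at h1
    have h2 := (((h1.const_mul ℓ).div (hasDerivAt_id' s) hs.ne').mul (hv s hs).hasDerivAt).add
      (h1.mul (hv' s hs).hasDerivAt)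
    have h3 : HasDerivAt (deriv u) _ s := h2.congr_of_eventuallyEq (by
      filter_upwards [lt_mem_nhds hs] with t ht
      exact (hud t ht).deriv)
    refine h3.congr_deriv ?_
    rw [(hud s hs).deriv, hu]
    have hb := hbessel s hs
    have hb' : deriv (deriv v) s = - (deriv v s / s) - (1 - ℓ^2/s^2) * v s := by linarith
    rw [hb']
    simp only [Pi.div_apply]
    have := hs.ne'
    field_simp
    ring
  have hwd : ∀ s : ℝ, 0 < s → u s ≠ 0 →
      HasDerivAt w ((2 * ℓ - 1) * w s / s - 1 - w s ^ 2) s := by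
    intro s hs h0
    have h := (hudd s hs).div (hud s hs).differentiableAt.hasDerivAt h0
    rw [hwdef]
    refine h.congr_deriv ?_
    have := hs.ne'
    field_simp
  intro s hs h0 hw0
  have h1 := hwd s hs h0
  have h2 := ((((h1.const_mul (2 * ℓ - 1)).div (hasDerivAt_id' s) hs.ne').sub_const 1).sub
    (h1.pow 2))
  have h3 : HasDerivAt (deriv w) _ s := h2.congr_of_eventuallyEq (by
    filter_upwards [lt_mem_nhds hs, (hud s hs).continuousAt.eventually_ne h0] with t ht ht0
    exact (hwd t ht ht0).deriv)
  rw [h3.deriv, h1.deriv]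
  have := hs.ne'
  field_simp
  ring
end

section
/- Let ℓ ∈ ℝ and let (χ, a) be a differentiable solution of system (isomnews) on an open interval I ⊆ (0,∞) with χ nonvanishing on I. Then the function w(s) := a(s)/(2s·χ(s)) is twice differentiable on I, and at every s ∈ I with w(s) ≠ 0 it satisfies the Painlevé 3 equation w''(s) = (w'(s))²/w(s) − w'(s)/s − 2ℓ·w(s)²/s + (2ℓ − 2)/s + w(s)³ − 1/w(s). -/
/-- If `(χ, a)` is a differentiable solution of system (isomnews) on an open interval
`I ⊆ (0,∞)` with `χ` nonvanishing, then `w(s) := a(s)/(2sχ(s))` is twice differentiable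
on `I` and satisfies the Painlevé 3 equation at every `s ∈ I` with `w s ≠ 0`. -/
theorem stmt_5 (ℓ : ℝ) (I : Set ℝ) (hIopen : IsOpen I) (hIconn : I.OrdConnected)
    (hIpos : I ⊆ Set.Ioi 0) (χ a : ℝ → ℝ)
    (hχ : ∀ s ∈ I, DifferentiableAt ℝ χ s) (ha : ∀ s ∈ I, DifferentiableAt ℝ a s)
    (hχne : ∀ s ∈ I, χ s ≠ 0)
    (hode1 : ∀ s ∈ I, deriv χ s = (a s - 2*χ s*(ℓ + 2*χ s*a s)) / (2*s))
    (hode2 : ∀ s ∈ I, deriv a s = -2*s*χ s + (a s/s)*(ℓ + 2*χ s*a s))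
    (w : ℝ → ℝ) (hw : w = fun s => a s / (2*s*χ s)) :
    (∀ s ∈ I, DifferentiableAt ℝ w s ∧ DifferentiableAt ℝ (deriv w) s) ∧
    (∀ s ∈ I, w s ≠ 0 → deriv (deriv w) s = (deriv w s)^2 / w s - deriv w s / s
      - 2*ℓ*(w s)^2/s + (2*ℓ - 2)/s + (w s)^3 - 1/(w s)) := by
  have hpos : ∀ s ∈ I, s ≠ 0 := fun s hs => ne_of_gt (hIpos hs)
  have hA : ∀ s ∈ I, HasDerivAt a (-2*s*χ s + (a s/s)*(ℓ + 2*χ s*a s)) s := fun s hs =>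
    hode2 s hs ▸ (ha s hs).hasDerivAt
  have hX : ∀ s ∈ I, HasDerivAt χ ((a s - 2*χ s*(ℓ + 2*χ s*a s)) / (2*s)) s := fun s hs =>
    hode1 s hs ▸ (hχ s hs).hasDerivAt
  have hW : ∀ s ∈ I, HasDerivAt w
      (-1 + 2*w s*((ℓ + 2*(χ s*a s))/s) - w s/s - (w s)^2) s := by
    intro s hs
    have h0 := hpos s hs
    have h1 := hχne s hs
    have h := (hA s hs).div (((hasDerivAt_id s).const_mul 2).mul (hX s hs))
      (by simp [h0, h1])
    rw [hw]
    refine h.congr_deriv ?_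
    simp only [Pi.mul_apply, id]
    field_simp
    ring
  have hU : ∀ s ∈ I, HasDerivAt (fun t => χ t * a t) ((a s)^2/(2*s) - 2*s*(χ s)^2) s := by
    intro s hs
    have h0 := hpos s hs
    refine ((hX s hs).mul (hA s hs)).congr_deriv ?_
    field_simp
    ring
  have hD : ∀ s ∈ I, HasDerivAt (deriv w)
      (2*(-1 + 2*w s*((ℓ + 2*(χ s*a s))/s) - w s/s - (w s)^2)*((ℓ + 2*(χ s*a s))/s)
        + 2*w s*(2*((a s)^2/(2*s) - 2*s*(χ s)^2)/s - (ℓ + 2*(χ s*a s))/s^2)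
        - ((-1 + 2*w s*((ℓ + 2*(χ s*a s))/s) - w s/s - (w s)^2)/s - w s/s^2)
        - 2*w s*(-1 + 2*w s*((ℓ + 2*(χ s*a s))/s) - w s/s - (w s)^2)) s := by
    intro s hs
    have h0 := hpos s hs
    have hev : deriv w =ᶠ[nhds s]
        fun t => -1 + 2*w t*((ℓ + 2*(χ t*a t))/t) - w t/t - (w t)^2 := by
      filter_upwards [hIopen.mem_nhds hs] with t ht using (hW t ht).deriv
    refine HasDerivAt.congr_of_eventuallyEq ?_ hev
    have h := (((((hW s hs).const_mul 2).mul
      ((((hU s hs).const_mul 2).const_add ℓ).div (hasDerivAt_id s) h0)).const_add (-1)).sub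
      ((hW s hs).div (hasDerivAt_id s) h0)).sub ((hW s hs).pow 2)
    refine h.congr_deriv ?_
    simp only [Pi.div_apply, id]
    field_simp
    ring
  refine ⟨fun s hs => ⟨(hW s hs).differentiableAt, (hD s hs).differentiableAt⟩, ?_⟩
  intro s hs hws
  have h0 := hpos s hs
  have h1 := hχne s hs
  rw [(hD s hs).deriv, (hW s hs).deriv]
  have has : a s = 2*s*χ s*w s := by
    rw [hw]; field_simp
  rw [has]
  generalize w s = y at *
  field_simp
  ring
end

section
/- Let ℓ ∈ ℝ and let (u, a) be a differentiable pair on an open interval I ⊆ (0,∞) with u nonvanishing, satisfying u'(s) = ( −a(s)·u(s)² + 2ℓ·u(s) + 4a(s) )/(2s) and a'(s) = (2/(u(s)·s))·(a(s)² − s²) + a(s)·ℓ/s on I. Then the function w(s) := a(s)·u(s)/(2s) satisfies on I the equation w'(s) = 2a(s)²/s² − 1 + ((2ℓ − 1)/s)·w(s) − w(s)². -/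
/-- If `(u, a)` is a differentiable, `u`-nonvanishing solution of system (prfield) on an
open interval `I ⊆ (0,∞)`, then `w(s) := a(s)u(s)/(2s)` satisfies
`w' = 2a²/s² − 1 + ((2ℓ−1)/s)w − w²` on `I`. -/
theorem stmt_7 (ℓ : ℝ) (I : Set ℝ) (hIopen : IsOpen I) (hIconn : I.OrdConnected)
    (hIpos : I ⊆ Set.Ioi 0) (u a : ℝ → ℝ)
    (hu : ∀ s ∈ I, DifferentiableAt ℝ u s) (ha : ∀ s ∈ I, DifferentiableAt ℝ a s)
    (hune : ∀ s ∈ I, u s ≠ 0)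
    (hode1 : ∀ s ∈ I, deriv u s = (-(a s)*(u s)^2 + 2*ℓ*u s + 4*a s)/(2*s))
    (hode2 : ∀ s ∈ I, deriv a s = (2/(u s * s))*((a s)^2 - s^2) + a s * ℓ / s)
    (w : ℝ → ℝ) (hw : w = fun s => a s * u s / (2*s)) :
    ∀ s ∈ I, deriv w s = 2*(a s)^2/s^2 - 1 + ((2*ℓ - 1)/s)*w s - (w s)^2 := by
  intro s hs
  have hs0 : s ≠ 0 := ne_of_gt (hIpos hs)
  have hu0 := hune s hs
  have h1 := (hu s hs).hasDerivAt
  have h2 := (ha s hs).hasDerivAt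
  have h3 : HasDerivAt (fun t : ℝ => 2 * t) (2 * 1) s := (hasDerivAt_id s).const_mul 2
  have h4 : HasDerivAt (fun t => a t * u t / (2 * t)) _ s :=
    (h2.mul h1).div h3 (mul_ne_zero two_ne_zero hs0)
  rw [hw, h4.deriv, hode1 s hs, hode2 s hs]
  simp only [Pi.mul_apply]
  field_simp
  ring
end

section
/- Let ℓ ∈ ℤ and y, θ₀ ∈ ℝ. Suppose θ : ℝ × ℝ × ℝ → ℝ, (a, s, τ) ↦ θ(a, s, τ), is three times continuously differentiable, θ(a, s, 0) = θ₀ for all (a, s), and ∂θ/∂τ (a, s, τ) = a·cos θ(a, s, τ) + ℓ + s·cos τ for all (a, s, τ). Then the mixed second derivative satisfies ∂²θ/∂a∂s (0, y, 2π) = π·cos θ₀ · ( J_{ℓ+1}(−y) − J_{ℓ−1}(−y) ), where J_m is the m-th Bessel function given by J_m(x) = (1/π)·∫₀^π cos(mτ − x·sin τ) dτ. -/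
/-- The `m`-th Bessel function of the first kind, `J_m(x) = (1/π)∫₀^π cos(mτ − x sin τ) dτ`. -/
noncomputable def besselJ (m : ℤ) (x : ℝ) : ℝ :=
  (1/Real.pi) * ∫ τ in (0:ℝ)..Real.pi, Real.cos ((m:ℝ)*τ - x*Real.sin τ)

open MeasureTheory Filter Topology in
lemma bessel_full (m : ℤ) (y θ₀ : ℝ) :
    ∫ τ in (0:ℝ)..(2*Real.pi), Real.cos (θ₀ + (m:ℝ)*τ + y*Real.sin τ)
      = 2 * Real.pi * Real.cos θ₀ * besselJ m (-y) := by
  set f : ℝ → ℝ := fun τ => Real.cos (θ₀ + (m:ℝ)*τ + y*Real.sin τ) with hf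
  have hc : Continuous f := by fun_prop
  have hc2 : Continuous (fun τ => f (2*Real.pi - τ)) := by fun_prop
  have h1 : ∫ τ in (0:ℝ)..Real.pi, f (2*Real.pi - τ) = ∫ τ in Real.pi..(2*Real.pi), f τ := by
    rw [intervalIntegral.integral_comp_sub_left]
    congr 1 <;> ring
  rw [← intervalIntegral.integral_add_adjacent_intervals (hc.intervalIntegrable 0 Real.pi)
    (hc.intervalIntegrable Real.pi (2*Real.pi)), ← h1,
    ← intervalIntegral.integral_add (hc.intervalIntegrable _ _)
      (hc2.intervalIntegrable _ _)]
  have h2 : ∀ τ, f τ + f (2*Real.pi - τ)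
      = (2 * Real.cos θ₀) * Real.cos ((m:ℝ)*τ - (-y)*Real.sin τ) := by
    intro τ
    have e1 : f τ = Real.cos (θ₀ + ((m:ℝ)*τ - (-y)*Real.sin τ)) := by
      simp only [hf]; congr 1; ring
    have e2 : f (2*Real.pi - τ) = Real.cos (θ₀ - ((m:ℝ)*τ - (-y)*Real.sin τ)) := by
      simp only [hf]
      rw [Real.sin_two_pi_sub, ← Real.cos_add_int_mul_two_pi (θ₀ - _) m]
      congr 1; ring
    rw [e1, e2, Real.cos_add, Real.cos_sub θ₀]; ring
  have h3 : (∫ x in (0:ℝ)..Real.pi, (f x + f (2*Real.pi - x))) =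
      ∫ τ in (0:ℝ)..Real.pi, (2 * Real.cos θ₀) * Real.cos ((m:ℝ)*τ - (-y)*Real.sin τ) := by
    congr 1; ext τ; exact h2 τ
  have h4 := Real.pi_ne_zero
  rw [h3, intervalIntegral.integral_const_mul, besselJ]
  field_simp

open MeasureTheory Filter Topology in
lemma hasDerivAt_param (F F' : ℝ → ℝ → ℝ) (b y : ℝ)
    (hF : Continuous (Function.uncurry F)) (hF' : Continuous (Function.uncurry F'))
    (hd : ∀ s t, HasDerivAt (fun s => F s t) (F' s t) s) :
    HasDerivAt (fun s => ∫ t in (0:ℝ)..b, F s t) (∫ t in (0:ℝ)..b, F' y t) y := by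
  obtain ⟨C, hC⟩ := ((isCompact_closedBall y 1).prod (isCompact_uIcc (a := (0:ℝ)) (b := b))).exists_bound_of_continuousOn
    hF'.continuousOn
  have cF : ∀ s, Continuous (F s) := fun s => hF.comp (Continuous.prodMk_right s)
  have cF' : ∀ s, Continuous (F' s) := fun s => hF'.comp (Continuous.prodMk_right s)
  refine (intervalIntegral.hasDerivAt_integral_of_dominated_loc_of_deriv_le
    (bound := fun _ => C) (F' := F') (Metric.closedBall_mem_nhds y one_pos)
    (Eventually.of_forall fun s => (cF s).aestronglyMeasurable)
    ((cF y).intervalIntegrable _ _) (cF' y).aestronglyMeasurable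
    (Eventually.of_forall fun t ht s hs => hC (s, t) ⟨hs, Set.uIoc_subset_uIcc ht⟩)
    intervalIntegrable_const (Eventually.of_forall fun t _ s _ => hd s t)).2

open MeasureTheory Filter Topology in
theorem stmt_15 (ℓ : ℤ) (y θ₀ : ℝ) (θ : ℝ → ℝ → ℝ → ℝ)
    (hsmooth : ContDiff ℝ 3 (fun p : ℝ × ℝ × ℝ => θ p.1 p.2.1 p.2.2))
    (hinit : ∀ a s : ℝ, θ a s 0 = θ₀)
    (hode : ∀ a s τ : ℝ, deriv (θ a s) τ = a * Real.cos (θ a s τ) + (ℓ:ℝ) + s * Real.cos τ) :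
    deriv (fun a => deriv (fun s => θ a s (2*Real.pi)) y) 0
      = Real.pi * Real.cos θ₀ * (besselJ (ℓ+1) (-y) - besselJ (ℓ-1) (-y)) := by
  have hθc := hsmooth.continuous
  have hθd : ∀ a s τ, HasDerivAt (θ a s) (a * Real.cos (θ a s τ) + (ℓ:ℝ) + s * Real.cos τ) τ := by
    intro a s τ
    rw [← hode]
    have : Differentiable ℝ (fun t : ℝ => θ a s t) :=
      (hsmooth.differentiable (by norm_num)).comp
        (g := fun p : ℝ × ℝ × ℝ => θ p.1 p.2.1 p.2.2) (f := fun t : ℝ => (a, s, t)) (by fun_prop)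
    exact (this τ).hasDerivAt
  have hcs : ∀ a s, Continuous (θ a s) := fun a s =>
    continuous_iff_continuousAt.2 fun τ => (hθd a s τ).continuousAt
  -- integral equation
  have hint : ∀ a s τ, θ a s τ
      = θ₀ + ℓ * τ + s * Real.sin τ + a * ∫ t in (0:ℝ)..τ, Real.cos (θ a s t) := by
    intro a s τ
    have hcc : Continuous fun t => Real.cos (θ a s t) := Real.continuous_cos.comp (hcs a s)
    have h2 := intervalIntegral.integral_eq_sub_of_hasDerivAt (a := 0) (b := τ)
      (fun t _ => hθd a s t) (Continuous.intervalIntegrable (by fun_prop) _ _)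
    rw [intervalIntegral.integral_add (Continuous.intervalIntegrable (by fun_prop) _ _)
      (Continuous.intervalIntegrable (by fun_prop) _ _),
      intervalIntegral.integral_add (Continuous.intervalIntegrable (by fun_prop) _ _)
      (Continuous.intervalIntegrable (by fun_prop) _ _),
      intervalIntegral.integral_const_mul, intervalIntegral.integral_const_mul,
      intervalIntegral.integral_const, integral_cos, hinit] at h2
    simp at h2
    linarith
  set Φ : ℝ × ℝ × ℝ → ℝ := fun p => Real.cos (θ p.1 p.2.1 p.2.2) with hΦ
  have hΦs : ContDiff ℝ 1 Φ := Real.contDiff_cos.comp (hsmooth.of_le (by norm_num))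
  have hΦc : Continuous Φ := hΦs.continuous
  have hΦ' : Continuous fun p => fderiv ℝ Φ p (0, 1, 0) :=
    (hΦs.continuous_fderiv (by norm_num)).clm_apply continuous_const
  have hd : ∀ a s t, HasDerivAt (fun s => Φ (a, s, t)) (fderiv ℝ Φ (a, s, t) (0, 1, 0)) s := by
    intro a s t
    have h := ((hΦs.differentiable (by norm_num)) (a, s, t)).hasFDerivAt
    exact h.comp_hasDerivAt (f := fun s : ℝ => (a, s, t)) s
      ((hasDerivAt_const s a).prodMk ((hasDerivAt_id s).prodMk (hasDerivAt_const s t)))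
  set g : ℝ → ℝ := fun a => ∫ t in (0:ℝ)..(2*Real.pi), fderiv ℝ Φ (a, y, t) (0, 1, 0) with hg
  have hgc : Continuous g := by
    apply intervalIntegral.continuous_parametric_intervalIntegral_of_continuous'
    exact hΦ'.comp (f := fun q : ℝ × ℝ => (q.1, y, q.2)) (by fun_prop)
  have hpar : ∀ a, HasDerivAt (fun s => ∫ t in (0:ℝ)..(2*Real.pi), Φ (a, s, t)) (g a) y := by
    intro a
    exact hasDerivAt_param (fun s t => Φ (a, s, t)) (fun s t => fderiv ℝ Φ (a, s, t) (0, 1, 0))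
      (2*Real.pi) y (hΦc.comp (f := fun q : ℝ × ℝ => (a, q.1, q.2)) (by fun_prop))
      (hΦ'.comp (f := fun q : ℝ × ℝ => (a, q.1, q.2)) (by fun_prop)) (hd a)
  have hinner : (fun a => deriv (fun s => θ a s (2*Real.pi)) y) = fun a => a * g a := by
    funext a
    have : (fun s => θ a s (2*Real.pi))
        = fun s => (θ₀ + ℓ * (2*Real.pi)) + a * ∫ t in (0:ℝ)..(2*Real.pi), Φ (a, s, t) := by
      funext s
      rw [hint a s (2*Real.pi)]
      simp [hΦ]
    rw [this]
    exact (((hpar a).const_mul a).const_add _).deriv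
  have hout : HasDerivAt (fun a => a * g a) (g 0) 0 := by
    rw [hasDerivAt_iff_tendsto_slope]
    refine (hgc.continuousAt.tendsto.mono_left nhdsWithin_le_nhds).congr' ?_
    filter_upwards [self_mem_nhdsWithin] with a ha
    have ha' : a ≠ 0 := ha
    simp [slope_def_field]
    field_simp
  rw [hinner, hout.deriv]
  have hzero : ∀ s t, Φ (0, s, t) = Real.cos (θ₀ + ℓ * t + s * Real.sin t) := by
    intro s t
    simp only [hΦ]
    rw [hint 0 s t]
    simp
  have hval : ∀ t, fderiv ℝ Φ (0, y, t) (0, 1, 0)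
      = (1/2) * (Real.cos (θ₀ + ((ℓ+1 : ℤ):ℝ) * t + y * Real.sin t)
        - Real.cos (θ₀ + ((ℓ-1 : ℤ):ℝ) * t + y * Real.sin t)) := by
    intro t
    have h1 := hd 0 y t
    simp only [hzero] at h1
    have h2 : HasDerivAt (fun s => Real.cos (θ₀ + ℓ * t + s * Real.sin t))
        (-Real.sin (θ₀ + ℓ * t + y * Real.sin t) * (1 * Real.sin t)) y :=
      (((hasDerivAt_id y).mul_const (Real.sin t)).const_add (θ₀ + ℓ * t)).cos
    rw [h1.unique h2]
    have e1 : θ₀ + ((ℓ+1 : ℤ):ℝ) * t + y * Real.sin t = (θ₀ + ℓ * t + y * Real.sin t) + t := by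
      push_cast; ring
    have e2 : θ₀ + ((ℓ-1 : ℤ):ℝ) * t + y * Real.sin t = (θ₀ + ℓ * t + y * Real.sin t) - t := by
      push_cast; ring
    rw [e1, e2, Real.cos_add, Real.cos_sub]; ring
  simp only [hg, hval]
  rw [intervalIntegral.integral_const_mul, intervalIntegral.integral_sub
    (Continuous.intervalIntegrable (by fun_prop) _ _)
    (Continuous.intervalIntegrable (by fun_prop) _ _), bessel_full, bessel_full]
  ring
end

section
/- Let ℓ ∈ ℝ, let U ⊆ ℂ∖{0} be a connected open set, s₀ ∈ U, and let w : U → ℂ be analytic, not identically zero, with w(s₀) = 0. Suppose that at every point s ∈ U with w(s) ≠ 0 the function w satisfies the Painlevé 3 equation w''(s) = (w'(s))²/w(s) − w'(s)/s − 2ℓ·w(s)²/s + (2ℓ − 2)/s + w(s)³ − 1/w(s). Then (w'(s₀))² = 1, i.e., w'(s₀) = 1 or w'(s₀) = −1. -/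
/-- Every zero of a not identically zero analytic solution of the Painlevé 3 equation (p3)
on a connected open set `U ⊆ ℂ∖{0}` has derivative `±1`. -/
theorem stmt_17 (ℓ : ℝ) (U : Set ℂ) (hUopen : IsOpen U) (hUconn : IsConnected U)
    (hU0 : ∀ z ∈ U, z ≠ 0) (s₀ : ℂ) (hs₀ : s₀ ∈ U) (w : ℂ → ℂ)
    (hw : DifferentiableOn ℂ w U) (hne : ¬ ∀ s ∈ U, w s = 0) (h0 : w s₀ = 0)
    (hode : ∀ s ∈ U, w s ≠ 0 → deriv (deriv w) s =
      (deriv w s)^2 / w s - deriv w s / s - 2*(ℓ:ℂ)*(w s)^2/s + (2*(ℓ:ℂ) - 2)/s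
        + (w s)^3 - 1/(w s)) :
    (deriv w s₀)^2 = 1 ∧ (deriv w s₀ = 1 ∨ deriv w s₀ = -1) := by
  have hwa : AnalyticOnNhd ℂ w U := hw.analyticOnNhd hUopen
  have hs0 : s₀ ≠ 0 := hU0 s₀ hs₀
  have a0 : ContinuousAt w s₀ := (hwa s₀ hs₀).continuousAt
  have a1 : ContinuousAt (deriv w) s₀ := (hwa s₀ hs₀).deriv.continuousAt
  have a2 : ContinuousAt (deriv (deriv w)) s₀ := (hwa s₀ hs₀).deriv.deriv.continuousAt
  have hev : ∀ᶠ z in nhdsWithin s₀ {s₀}ᶜ, w z ≠ 0 := by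
    rcases (hwa s₀ hs₀).eventually_eq_zero_or_eventually_ne_zero with h | h
    · exact absurd (fun s hs =>
        hwa.eqOn_zero_of_preconnected_of_eventuallyEq_zero hUconn.isPreconnected hs₀ h hs) hne
    · exact h
  have hU : ∀ᶠ z in nhdsWithin s₀ {s₀}ᶜ, z ∈ U :=
    nhdsWithin_le_nhds (hUopen.mem_nhds hs₀)
  let F : ℂ → ℂ := fun s => (deriv w s)^2 - w s * deriv (deriv w) s - w s * deriv w s / s
    - 2*(ℓ:ℂ)*(w s)^3/s + (2*(ℓ:ℂ) - 2) * w s/s + (w s)^4 - 1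
  have hF : ContinuousAt F s₀ := by
    have hid : ContinuousAt (fun s : ℂ => s) s₀ := continuousAt_id
    exact ((((((a1.pow 2).sub (a0.mul a2)).sub ((a0.mul a1).div hid hs0)).sub
      ((continuousAt_const.mul (a0.pow 3)).div hid hs0)).add
      ((continuousAt_const.mul a0).div hid hs0)).add (a0.pow 4)).sub continuousAt_const
  have hFz : ∀ᶠ z in nhdsWithin s₀ {s₀}ᶜ, (0:ℂ) = F z := by
    filter_upwards [hev, hU] with z hz hzU
    have hz0 := hU0 z hzU
    have h := hode z hzU hz
    simp only [F]
    rw [h]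
    field_simp
    ring
  have h1 : Filter.Tendsto F (nhdsWithin s₀ {s₀}ᶜ) (nhds (F s₀)) :=
    hF.tendsto.mono_left nhdsWithin_le_nhds
  have h2 : Filter.Tendsto F (nhdsWithin s₀ {s₀}ᶜ) (nhds 0) :=
    tendsto_const_nhds.congr' hFz
  have h3 : F s₀ = 0 := tendsto_nhds_unique h1 h2
  have h4 : (deriv w s₀)^2 = 1 := by
    simp only [F, h0] at h3
    ring_nf at h3
    linear_combination h3
  exact ⟨h4, mul_self_eq_one_iff.mp (by rw [← sq]; exact h4)⟩
end

section
/- Let ℓ ∈ ℝ and let v : (0,∞) → ℝ be a twice differentiable solution of the Bessel equation v''(s) + v'(s)/s + (1 − ℓ²/s²)·v(s) = 0 on (0,∞), not identically zero. Then the zero set of v is unbounded: for every M > 0 there exists s > M with v(s) = 0. -/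
lemma aux_anti (N : ℝ) (f f' : ℝ → ℝ) (h : ∀ s, N < s → HasDerivAt f (f' s) s)
    (h' : ∀ s, N < s → f' s ≤ 0) {x y : ℝ} (hx : N < x) (hxy : x ≤ y) : f y ≤ f x := by
  have : AntitoneOn f (Set.Ioi N) := by
    apply antitoneOn_of_deriv_nonpos (convex_Ioi N)
    · intro s hs
      exact (h s hs).continuousAt.continuousWithinAt
    · intro s hs
      rw [interior_Ioi] at hs
      exact (h s hs).differentiableAt.differentiableWithinAt
    · intro s hs
      rw [interior_Ioi] at hs
      rw [(h s hs).deriv]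
      exact h' s hs
  exact this hx (lt_of_lt_of_le hx hxy) hxy

lemma aux_pos (ℓ : ℝ) (v w z : ℝ → ℝ)
    (hv : ∀ s : ℝ, 0 < s → HasDerivAt v (w s) s)
    (hw : ∀ s : ℝ, 0 < s → HasDerivAt w (z s) s)
    (hb : ∀ s : ℝ, 0 < s → z s + w s / s + (1 - ℓ^2/s^2)*v s = 0)
    (M : ℝ) (hpos : ∀ s, M < s → 0 < v s) : False := by
  obtain ⟨N, hNM, hN⟩ : ∃ N, M ≤ N ∧ ℓ^2 + 1 ≤ N := ⟨_, le_max_left _ _, le_max_right _ _⟩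
  have hN0 : 0 < N := by nlinarith [sq_nonneg ℓ]
  have hp : ∀ s, N < s → HasDerivAt (fun s => s * w s) (1 * w s + s * z s) s := fun s hs =>
    (hasDerivAt_id' s).mul (hw s (hN0.trans hs))
  have hp' : ∀ s, N < s → 1 * w s + s * z s ≤ - v s := by
    intro s hs
    have hs0 : 0 < s := hN0.trans hs
    have h1 := hb s hs0
    have h2 := hpos s (hNM.trans_lt hs)
    have h3 : 1 * w s + s * z s = -((s - ℓ^2/s) * v s) := by
      field_simp at h1 ⊢
      linarith
    have h4 : 1 ≤ s - ℓ^2/s := by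
      have : ℓ^2/s ≤ s - 1 := by
        rw [div_le_iff₀ hs0]
        nlinarith [sq_nonneg ℓ]
      linarith
    rw [h3]
    nlinarith
  have hanti : ∀ x y, N < x → x ≤ y → y * w y ≤ x * w x := fun x y hx hxy =>
    aux_anti N _ _ hp (fun s hs => (hp' s hs).trans
      (by linarith [hpos s (hNM.trans_lt hs)])) hx hxy
  by_cases hc : ∃ a, N < a ∧ a * w a < 0
  · obtain ⟨a, ha, hac⟩ := hc
    obtain ⟨c, hcdef⟩ : ∃ c, c = -(a * w a) := ⟨_, rfl⟩
    have hc0 : 0 < c := by linarith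
    have key : ∀ y, a + 1 ≤ y →
        v y + c * Real.log y ≤ v (a+1) + c * Real.log (a+1) := fun y hy =>
      aux_anti a (fun s => v s + c * Real.log s) (fun s => w s + c * s⁻¹)
        (fun s hs => (hv s (by linarith)).add
          ((Real.hasDerivAt_log (by linarith)).const_mul c))
        (fun s hs => by
          have hs0 : 0 < s := by linarith
          have h1 := hanti a s ha hs.le
          have : w s + c * s⁻¹ = (s * w s + c) / s := by field_simp
          rw [this]
          exact div_nonpos_of_nonpos_of_nonneg (by linarith) hs0.le)
        (by linarith) hy
    set K := v (a+1) + c * Real.log (a+1) with hK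
    have h1 := key (max (a+1) (Real.exp (K/c))) (le_max_left _ _)
    have h2 : K / c ≤ Real.log (max (a+1) (Real.exp (K/c))) := by
      rw [Real.le_log_iff_exp_le (lt_max_of_lt_right (Real.exp_pos _))]
      exact le_max_right _ _
    have h3 := hpos (max (a+1) (Real.exp (K/c))) (lt_max_of_lt_left (by linarith))
    rw [div_le_iff₀ hc0] at h2
    linarith
  · push Not at hc
    have hmono : ∀ y, N + 1 ≤ y → v (N+1) ≤ v y := fun y hy => by
      have := aux_anti N (fun s => - v s) (fun s => - w s)
        (fun s hs => (hv s (by linarith)).neg)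
        (fun s hs => by
          have := nonneg_of_mul_nonneg_right (hc s hs) (by linarith)
          linarith) (by linarith : N < N + 1) hy
      simpa using this
    obtain ⟨c, hcdef⟩ : ∃ c, c = v (N+1) := ⟨_, rfl⟩
    have hc0 : 0 < c := hcdef ▸ hpos _ (by linarith)
    have key : ∀ y, N + 2 ≤ y →
        y * w y + c * y ≤ (N+2) * w (N+2) + c * (N+2) := fun y hy =>
      aux_anti (N+1) (fun s => s * w s + c * s) (fun s => (1 * w s + s * z s) + c * 1)
        (fun s hs => (hp s (by linarith)).add ((hasDerivAt_id' s).const_mul c))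
        (fun s hs => by
          have h1 := hp' s (by linarith)
          have h2 := hmono s hs.le
          show (1 * w s + s * z s) + c * 1 ≤ 0
          linarith)
        (by linarith) hy
    set K := (N+2) * w (N+2) + c * (N+2) with hK
    have h1 := key (max (N+2) ((K+1)/c)) (le_max_left _ _)
    have h2 : (K+1)/c ≤ max (N+2) ((K+1)/c) := le_max_right _ _
    have h3 := hc (max (N+2) ((K+1)/c)) (lt_max_of_lt_left (by linarith))
    rw [div_le_iff₀ hc0] at h2
    linarith


/-- A not identically zero twice differentiable solution of the Bessel equation of order
`ℓ` on `(0,∞)` has an unbounded set of zeros. -/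
theorem stmt_18 (ℓ : ℝ) (v : ℝ → ℝ)
    (hv : ∀ s : ℝ, 0 < s → DifferentiableAt ℝ v s)
    (hv' : ∀ s : ℝ, 0 < s → DifferentiableAt ℝ (deriv v) s)
    (hbessel : ∀ s : ℝ, 0 < s →
      deriv (deriv v) s + deriv v s / s + (1 - ℓ^2/s^2)*v s = 0)
    (hne : ¬ ∀ s : ℝ, 0 < s → v s = 0) :
    ∀ M : ℝ, 0 < M → ∃ s : ℝ, M < s ∧ v s = 0 := by

  intro M hM
  by_contra hcon
  push Not at hcon
  have h1 : ∀ s : ℝ, 0 < s → HasDerivAt v (deriv v s) s := fun s hs => (hv s hs).hasDerivAt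
  have h2 : ∀ s : ℝ, 0 < s → HasDerivAt (deriv v) (deriv (deriv v) s) s :=
    fun s hs => (hv' s hs).hasDerivAt
  have hcont : ContinuousOn v (Set.Ioi M) := fun s hs =>
    (hv s (hM.trans hs)).continuousAt.continuousWithinAt
  by_cases hex : ∃ a, M < a ∧ v a < 0
  · obtain ⟨a, ha, hva⟩ := hex
    refine aux_pos ℓ (fun s => - v s) (fun s => - deriv v s) (fun s => - deriv (deriv v) s)
      (fun s hs => (h1 s hs).neg) (fun s hs => (h2 s hs).neg)
      (fun s hs => by have := hbessel s hs; simp only [neg_div]; linarith) M ?_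
    intro s hs
    by_contra hneg
    obtain ⟨t, ht, ht0⟩ := isPreconnected_Ioi.intermediate_value (Set.mem_Ioi.2 ha)
      (Set.mem_Ioi.2 hs) hcont (show (0:ℝ) ∈ Set.Icc (v a) (v s) from ⟨hva.le, by linarith⟩)
    exact hcon t ht ht0
  · push Not at hex
    exact aux_pos ℓ v _ _ h1 h2 hbessel M
      (fun s hs => lt_of_le_of_ne (hex s hs) (Ne.symm (hcon s hs)))
end

section
/- Let ℓ ∈ ℝ, s₀ ∈ ℂ∖{0}, and let D ⊆ ℂ∖{0} be a punctured disc centered at s₀. Let χ, a : D → ℂ be holomorphic, with χ nonvanishing on D, satisfying system (isomnews): χ'(s) = (a(s) − 2χ(s)(ℓ + 2χ(s)a(s)))/(2s), a'(s) = −2sχ(s) + (a(s)/s)(ℓ + 2χ(s)a(s)). Suppose that |χ(s)| → ∞ as s → s₀, and that the function w(s) := a(s)/(2s·χ(s)) extends holomorphically to s₀ with w(s₀) = 0. Then: (1) w'(s₀) = 1; (2) a extends holomorphically to s₀ and a(s₀) = s₀ or a(s₀) = −s₀; (3) χ has a simple pole at s₀ with residue a(s₀)/(2s₀) ∈ {1/2,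 −1/2}, i.e., (s − s₀)·χ(s) → a(s₀)/(2s₀) as s → s₀. -/
/-- Singularity analysis for system (isomnews): if a holomorphic solution `(χ, a)` on a
punctured disc `D ⊆ ℂ∖{0}` around `s₀` has `|χ| → ∞` at `s₀`, while `w := a/(2sχ)` extends
holomorphically to `s₀` with `w(s₀) = 0`, then `w'(s₀) = 1`, `a` extends holomorphically
to `s₀` with `a(s₀) = ±s₀`, and `χ` has a simple pole at `s₀` with residue
`a(s₀)/(2s₀) ∈ {1/2, −1/2}`. -/
theorem stmt_19 (ℓ : ℝ) (s₀ : ℂ) (hs₀ : s₀ ≠ 0) (r : ℝ) (hr : 0 < r)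
    (D : Set ℂ) (hD : D = Metric.ball s₀ r \ {s₀}) (hD0 : ∀ z ∈ D, z ≠ 0)
    (χ a : ℂ → ℂ)
    (hχ : ∀ s ∈ D, DifferentiableAt ℂ χ s) (ha : ∀ s ∈ D, DifferentiableAt ℂ a s)
    (hχne : ∀ s ∈ D, χ s ≠ 0)
    (hode1 : ∀ s ∈ D, deriv χ s = (a s - 2*χ s*((ℓ:ℂ) + 2*χ s*a s))/(2*s))
    (hode2 : ∀ s ∈ D, deriv a s = -2*s*χ s + (a s/s)*((ℓ:ℂ) + 2*χ s*a s))
    (hblow : Filter.Tendsto (fun s => ‖χ s‖) (nhdsWithin s₀ D) Filter.atTop)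
    (W : ℂ → ℂ) (hWeq : Set.EqOn W (fun s => a s/(2*s*χ s)) D)
    (hWanalytic : AnalyticAt ℂ W s₀) (hW0 : W s₀ = 0) :
    deriv W s₀ = 1 ∧
    ∃ A : ℂ → ℂ, Set.EqOn A a D ∧ AnalyticAt ℂ A s₀ ∧
      (A s₀ = s₀ ∨ A s₀ = -s₀) ∧
      (A s₀/(2*s₀) = 1/2 ∨ A s₀/(2*s₀) = -(1/2)) ∧
      Filter.Tendsto (fun s => (s - s₀)*χ s) (nhdsWithin s₀ D) (nhds (A s₀/(2*s₀))) := by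
  have hDo : IsOpen D := by
    rw [hD]; exact Metric.isOpen_ball.sdiff isClosed_singleton
  have hnh : nhdsWithin s₀ D = nhdsWithin s₀ {s₀}ᶜ := by
    rw [hD, Set.sdiff_eq]
    exact nhdsWithin_inter_of_mem (mem_nhdsWithin_of_mem_nhds (Metric.ball_mem_nhds s₀ hr))
  have hs₀D : s₀ ∉ D := by rw [hD]; simp
  have hDmem : ∀ᶠ s in nhdsWithin s₀ {s₀}ᶜ, s ∈ D := by
    rw [← hnh]; exact self_mem_nhdsWithin
  obtain ⟨U, hU⟩ : ∃ U : ℂ → ℂ, U = Function.update (fun s => (χ s)⁻¹) s₀ 0 := ⟨_, rfl⟩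
  have hU0 : U s₀ = 0 := by rw [hU]; simp
  have hUD : ∀ s ∈ D, U s = (χ s)⁻¹ := by
    intro s hs
    have : s ≠ s₀ := fun h => hs₀D (h ▸ hs)
    rw [hU]; simp [this]
  have hUev : ∀ s ∈ D, U =ᶠ[nhds s] fun s => (χ s)⁻¹ := by
    intro s hs
    filter_upwards [hDo.mem_nhds hs] with z hz using hUD z hz
  have hUd : ∀ s ∈ D, DifferentiableAt ℂ U s := fun s hs =>
    ((hχ s hs).inv (hχne s hs)).congr_of_eventuallyEq (hUev s hs)
  have hUc : ContinuousAt U s₀ := by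
    rw [hU, continuousAt_update_same, ← hnh]
    exact Filter.tendsto_inv₀_cobounded.comp (tendsto_norm_atTop_iff_cobounded.1 hblow)
  have hUa : AnalyticAt ℂ U s₀ :=
    Complex.analyticAt_of_differentiable_on_punctured_nhds_of_continuousAt
      (hDmem.mono hUd) hUc
  have hUderiv : ∀ s ∈ D, deriv U s = -deriv χ s / (χ s)^2 := by
    intro s hs
    rw [(hUev s hs).deriv_eq]
    exact ((hχ s hs).hasDerivAt.inv (hχne s hs)).deriv
  obtain ⟨A, hA⟩ : ∃ A : ℂ → ℂ, A = fun s => s/2*(deriv U s + U s * W s) - (ℓ:ℂ)/2*U s :=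
    ⟨_, rfl⟩
  have hAa : AnalyticAt ℂ A s₀ := by
    rw [hA]
    have := hUa.deriv
    fun_prop
  have hAD : Set.EqOn A a D := by
    intro s hs
    have h1 := hχne s hs
    have h2 := hD0 s hs
    rw [hA]
    simp only
    rw [hUderiv s hs, hode1 s hs, hUD s hs, hWeq hs]
    field_simp
    ring
  have hA0 : A s₀ = s₀/2 * deriv U s₀ := by rw [hA]; simp [hU0]
  -- value of A
  have hAder : ∀ s ∈ D, U s * deriv A s = -2*s + (A s/s)*((ℓ:ℂ)*U s + 2*A s) := by
    intro s hs
    have h1 := hχne s hs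
    have h2 := hD0 s hs
    have : A =ᶠ[nhds s] a := by
      filter_upwards [hDo.mem_nhds hs] with z hz using hAD hz
    rw [this.deriv_eq, hode2 s hs, hUD s hs, hAD hs]
    field_simp
  have hlim : U s₀ * deriv A s₀ = -2*s₀ + (A s₀/s₀)*((ℓ:ℂ)*U s₀ + 2*A s₀) := by
    have c1 : ContinuousAt (fun s => U s * deriv A s) s₀ := hUc.mul hAa.deriv.continuousAt
    have c2 : ContinuousAt (fun s => -2*s + (A s/s)*((ℓ:ℂ)*U s + 2*A s)) s₀ := by
      have := hAa.continuousAt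
      fun_prop (disch := assumption)
    refine tendsto_nhds_unique (f := fun s => U s * deriv A s) (l := nhdsWithin s₀ {s₀}ᶜ)
      (c1.tendsto.mono_left nhdsWithin_le_nhds) ?_
    exact (c2.tendsto.mono_left nhdsWithin_le_nhds).congr'
      (hDmem.mono fun s hs => (hAder s hs).symm)
  have hsq : A s₀ ^ 2 = s₀ ^ 2 := by
    rw [hU0] at hlim
    field_simp at hlim
    linear_combination (-1/2) * hlim
  have hAne : A s₀ ≠ 0 := by
    intro h
    rw [h] at hsq
    exact hs₀ (by simpa using hsq.symm)
  have hUd0 : deriv U s₀ = 2 * A s₀ / s₀ := by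
    rw [hA0]; field_simp
  have hor : A s₀ = s₀ ∨ A s₀ = -s₀ := sq_eq_sq_iff_eq_or_eq_neg.1 hsq
  have hWev : W =ᶠ[nhds s₀] fun s => U s * (A s/(2*s)) := by
    have := eventually_nhdsWithin_iff.1 hDmem
    filter_upwards [this] with s hs
    by_cases h : s = s₀
    · rw [h, hW0, hU0, zero_mul]
    · have hs := hs h
      have h1 := hχne s hs
      have h2 := hD0 s hs
      rw [hWeq hs, hUD s hs, hAD hs]
      field_simp
  have hdW : deriv W s₀ = 1 := by
    rw [hWev.deriv_eq]
    have hd : DifferentiableAt ℂ (fun s => A s/(2*s)) s₀ :=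
      hAa.differentiableAt.div (by fun_prop) (by simpa using hs₀)
    have := (hUa.differentiableAt.hasDerivAt.mul hd.hasDerivAt).deriv
    refine Eq.trans this ?_
    rw [hU0, hUd0]
    field_simp
    linear_combination hsq
  refine ⟨hdW, A, hAD, hAa, hor, ?_, ?_⟩
  · rcases hor with h | h
    · left; rw [h]; field_simp
    · right; rw [h]; field_simp
  · have hsl := hasDerivAt_iff_tendsto_slope.1 hUa.differentiableAt.hasDerivAt
    have hne : deriv U s₀ ≠ 0 := by rw [hUd0]; exact div_ne_zero (mul_ne_zero two_ne_zero hAne) hs₀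
    have h := hsl.inv₀ hne
    have he : (deriv U s₀)⁻¹ = A s₀/(2*s₀) := by
      rw [hUd0]; field_simp; linear_combination -hsq
    rw [he] at h
    rw [hnh]
    refine h.congr' (hDmem.mono fun s hs => ?_)
    rw [slope_def_field, hU0, hUD s hs]
    simp [div_eq_mul_inv]
end
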